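/- For any prime p ≡ 1 (mod 4) and any positive integer r, ∑_{k=0}^{p^r-1} (1/2)_k^3 / k!^3 ≡ -Γ_p(1/4)^4 · ∑_{k=0}^{p^{r-1}-1} (1/2)_k^3 / k!^3 (mod p^{r+1}), as a congruence in Z_p. -/

import Mathlib

open Finset

/-- The rising factorial `(a)_k` in `ℚ_p`. -/
noncomputable def asc {p : ℕ} [Fact p.Prime] (a : ℚ_[p]) (k : ℕ) : ℚ_[p] :=
  ∏ i ∈ Finset.range k, (a + i)

section gen
set_option linter.unusedSectionVars false
variable {F : Type*} [Field F] [CharZero F]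

/-- `(1/2)_k / k!`. -/
def cA (F : Type*) [Field F] (k : ℕ) : F := ∏ i ∈ range k, ((1/2 + (i:F)) / ((i:F)+1))

/-- Even Newton basis. -/
def cE (k : ℕ) (a : F) : F := ∏ j ∈ range k, (((2*(j:F)+1)^2 - a^2) / (4*((j:F)+1)^2))

theorem cA_succ (k : ℕ) : cA F (k+1) = cA F k * ((1/2 + (k:F)) / ((k:F)+1)) := by
  rw [cA, prod_range_succ, cA]

theorem cE_succ (k : ℕ) (a : F) :
    cE (k+1) a = cE k a * (((2*(k:F)+1)^2 - a^2) / (4*((k:F)+1)^2)) := by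
  rw [cE, prod_range_succ, cE]

theorem cE_zero_right (k : ℕ) : cE k (0:F) = cA F k ^ 2 := by
  rw [cE, cA, ← prod_pow]
  refine prod_congr rfl fun i _ => ?_
  have : (i:F) + 1 ≠ 0 := by exact_mod_cast Nat.succ_ne_zero i
  field_simp
  ring

theorem cE_eq_zero (k x : ℕ) (h : x < k) : cE k (2*(x:F)+1) = 0 := by
  rw [cE]
  apply prod_eq_zero (mem_range.2 h)
  simp

theorem cE_shift (m k : ℕ) :
    cE k (2*((m+2 : ℕ):F)+1) * (((m:F)+2-k)*((m:F)+1-k))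
      = cE k (2*(m:F)+1) * (((m:F)+1+k)*((m:F)+2+k)) := by
  induction k with
  | zero => simp [cE]; ring
  | succ k ih =>
    rw [cE_succ, cE_succ]
    have h1 : (k:F) + 1 ≠ 0 := by exact_mod_cast Nat.succ_ne_zero k
    have e1 : ((2*(k:F)+1)^2 - (2*((m+2:ℕ):F)+1)^2) = -4 * (((m:F)+2-k)*(k+m+3)) := by
      push_cast; ring
    have e2 : ((2*(k:F)+1)^2 - (2*(m:F)+1)^2) = -4 * (((m:F)-k)*(k+m+1)) := by
      push_cast; ring
    rw [e1, e2]
    push_cast at ih ⊢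
    field_simp
    linear_combination (-((m:F)-k)*(k+m+3)) * ih

theorem wz_partial (m K : ℕ) :
    ∑ k ∈ range K, (((m:F)+2)^2 * (cA F k * cE k (2*((m+2 : ℕ):F)+1))
        - ((m:F)+1)^2 * (cA F k * cE k (2*(m:F)+1)))
      = -2*(2*(m:F)+3) * (K:F)^3 * (cA F K * cE K (2*((m+2 : ℕ):F)+1))
          / (((m:F)+1+K)*((m:F)+2+K)) := by
  induction K with
  | zero => simp
  | succ k ih =>
    rw [sum_range_succ, ih, cA_succ, cE_succ]
    have h0 : (k:F) + 1 ≠ 0 := by exact_mod_cast Nat.succ_ne_zero k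
    have h1 : (m:F)+1+k ≠ 0 := by exact_mod_cast (by omega : m+1+k ≠ 0)
    have h2 : (m:F)+2+k ≠ 0 := by exact_mod_cast (by omega : m+2+k ≠ 0)
    have h3 : (m:F)+3+k ≠ 0 := by exact_mod_cast (by omega : m+3+k ≠ 0)
    have hs := cE_shift (F := F) m k
    have hs' : cE k (2*(m:F)+1) = cE k (2*((m+2 : ℕ):F)+1) * (((m:F)+2-k)*((m:F)+1-k))
      / (((m:F)+1+k)*((m:F)+2+k)) := by
      field_simp; linear_combination -hs
    have e1 : ((2*(k:F)+1)^2 - (2*((m+2:ℕ):F)+1)^2) = -4 * (((m:F)+2-k)*(m+3+k)) := by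
      push_cast; ring
    rw [hs', e1]
    generalize cE k (2*((m+2 : ℕ):F)+1) = X
    have h4 : (m:F)+1+((k+1:ℕ):F) = m+2+k := by push_cast; ring
    have h5 : (m:F)+2+((k+1:ℕ):F) = m+3+k := by push_cast; ring
    rw [h4, h5]
    push_cast
    field_simp
    ring

theorem sum_rec (m K : ℕ) (hK : m + 2 < K) :
    ((m:F)+2)^2 * ∑ k ∈ range K, (cA F k * cE k (2*((m+2 : ℕ):F)+1))
      = ((m:F)+1)^2 * ∑ k ∈ range K, (cA F k * cE k (2*(m:F)+1)) := by
  have h := wz_partial (F := F) m K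
  rw [cE_eq_zero K (m+2) hK, sum_sub_distrib, ← mul_sum, ← mul_sum] at h
  simp only [mul_zero, zero_div] at h
  linear_combination h

theorem sum_even (z K : ℕ) (hK : 2*z < K) :
    ∑ k ∈ range K, (cA F k * cE k (2*((2*z : ℕ):F)+1)) = cA F z ^ 2 := by
  induction z with
  | zero =>
    obtain ⟨K, rfl⟩ : ∃ L, K = L+1 := ⟨K-1, by omega⟩
    rw [sum_range_succ']
    rw [sum_eq_zero]
    · simp [cA, cE]
    · intro k _
      rw [cE_eq_zero (k+1) (2*0) (by omega)]; simp
  | succ z ih =>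
    have := sum_rec (F := F) (2*z) K (by omega)
    rw [ih (by omega)] at this
    rw [show 2*(z+1) = 2*z+2 by ring, cA_succ]
    have h0 : (z:F) + 1 ≠ 0 := by exact_mod_cast Nat.succ_ne_zero z
    have h2 : (((2*z:ℕ):F)+2)^2 ≠ 0 := by
      apply pow_ne_zero; exact_mod_cast (by omega : 2*z+2 ≠ 0)
    apply mul_left_cancel₀ h2
    rw [this]
    push_cast
    field_simp
    ring

theorem sum_odd (z K : ℕ) (hK : 2*z+1 < K) :
    ∑ k ∈ range K, (cA F k * cE k (2*((2*z+1 : ℕ):F)+1)) = 0 := by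
  induction z with
  | zero =>
    obtain ⟨K, rfl⟩ : ∃ L, K = L+1+1 := ⟨K-2, by omega⟩
    rw [sum_range_succ', sum_range_succ']
    rw [sum_eq_zero]
    · simp [cA, cE]; norm_num
    · intro k _
      rw [cE_eq_zero (k+1+1) (2*0+1) (by omega)]; simp
  | succ z ih =>
    have := sum_rec (F := F) (2*z+1) K (by omega)
    rw [ih (by omega), mul_zero] at this
    rw [show 2*(z+1)+1 = 2*z+1+2 by ring]
    have h2 : (((2*z+1:ℕ):F)+2)^2 ≠ 0 := by
      apply pow_ne_zero; exact_mod_cast (by omega : 2*z+1+2 ≠ 0)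
    exact (mul_eq_zero.1 this).resolve_left h2

/-- Lagrange coefficient at `0` for nodes `(2x+1)^2`, `x < N`. -/
noncomputable def cL (F : Type*) [Field F] (N x : ℕ) : F :=
  ∏ y ∈ (range N).erase x, ((2*(y:F)+1)^2 / ((2*(y:F)+1)^2 - (2*(x:F)+1)^2))

theorem node_inj (N : ℕ) : Set.InjOn (fun x : ℕ => (2*(x:F)+1)^2) (range N : Finset ℕ) := by
  intro x _ y _ h
  have : (2*x+1)^2 = (2*y+1)^2 := by
    simp only at h; exact_mod_cast h
  have := Nat.pow_left_injective (n := 2) (by norm_num) this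
  omega

theorem lagrange_low (N j : ℕ) (hj : j < N) :
    cE j (0:F) = ∑ x ∈ range N, cL F N x * cE j (2*(x:F)+1) := by
  classical
  let P : Polynomial F := ∏ i ∈ range j, (Polynomial.C (1/(4*((i:F)+1)^2)) *
    (Polynomial.C ((2*(i:F)+1)^2) - Polynomial.X))
  have hP : ∀ a : F, P.eval (a^2) = cE j a := by
    intro a
    simp only [P, Polynomial.eval_prod, cE]
    refine prod_congr rfl fun i _ => ?_
    have : (i:F) + 1 ≠ 0 := by exact_mod_cast Nat.succ_ne_zero i
    simp only [Polynomial.eval_mul, Polynomial.eval_sub, Polynomial.eval_C, Polynomial.eval_X]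
    field_simp
  have hdeg : P.degree < (range N).card := by
    have : P.degree ≤ ∑ i ∈ range j, (1 : WithBot ℕ) := by
      refine (Polynomial.degree_prod_le _ _).trans (sum_le_sum fun i _ => ?_)
      compute_degree
    refine this.trans_lt ?_
    simp
    exact_mod_cast hj
  have := Lagrange.eq_interpolate_of_eval_eq (f := P) (fun x : ℕ => cE j (2*(x:F)+1))
    (node_inj (F := F) N) hdeg (fun x _ => hP _)
  have h0 := hP 0
  rw [← h0, this, Lagrange.interpolate_apply, Polynomial.eval_finsetSum]
  refine sum_congr rfl fun x hx => ?_
  rw [Polynomial.eval_mul, Polynomial.eval_C, mul_comm, Lagrange.basis, Polynomial.eval_prod, cL]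
  congr 1
  refine prod_congr rfl fun y hy => ?_
  simp [Lagrange.basisDivisor]
  rw [← neg_sub, inv_neg, div_eq_mul_inv]
  ring

/-- tail functional -/
noncomputable def tau (N : ℕ) (h : F → F) : F :=
  h 0 - ∑ x ∈ range N, cL F N x * h (2*(x:F)+1)

theorem tau_low (N j : ℕ) (hj : j < N) : tau N (cE (F := F) j) = 0 := by
  rw [tau, ← lagrange_low N j hj, sub_self]

theorem tau_high (N j : ℕ) (hj : N ≤ j) : tau N (cE (F := F) j) = cA F j ^ 2 := by
  rw [tau, sum_eq_zero, sub_zero, cE_zero_right]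
  intro x hx
  rw [cE_eq_zero j x (by have := mem_range.1 hx; omega), mul_zero]

theorem tau_add (N : ℕ) (c d : F) (f g : F → F) :
    tau N (fun a => c * f a + d * g a) = c * tau N f + d * tau N g := by
  simp only [tau, mul_sub, mul_sum, mul_add, sum_add_distrib]
  simp only [mul_left_comm]
  ring

theorem tau_sum {ι : Type*} (s : Finset ι) (N : ℕ) (c : ι → F) (f : ι → F → F) :
    tau N (fun a => ∑ i ∈ s, c i * f i a) = ∑ i ∈ s, c i * tau N (f i) := by
  classical
  induction s using Finset.induction_on with
  | empty => simp [tau]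
  | insert i s hi ih =>
    simp only [sum_insert hi]
    rw [← ih]
    have := tau_add N (c i) 1 (f i) (fun a => ∑ i ∈ s, c i * f i a)
    simpa using this

theorem erase_prod (x d : ℕ) :
    (∏ y ∈ (range (x+1+d)).erase x, ((2*(y:F)+1)^2 - (2*(x:F)+1)^2)) * (2*x+1)
      = (-1)^x * 4^(x+d) * ((d.factorial : F) * ((2*x+1+d).factorial : F)) := by
  induction d with
  | zero =>
    have h1 : (range (x+1+0)).erase x = range x := by
      ext y; simp; omega
    rw [h1]
    have h2 : ∀ y ∈ range x, ((2*(y:F)+1)^2 - (2*(x:F)+1)^2)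
        = (-1) * 4 * (((x - y : ℕ):F) * ((x + 1 + y : ℕ) : F)) := by
      intro y hy
      rw [Nat.cast_sub (mem_range.1 hy).le]; push_cast; ring
    rw [prod_congr rfl h2, prod_mul_distrib, prod_const, prod_mul_distrib, card_range, mul_pow,
      ← Nat.cast_prod, ← Nat.cast_prod, ← Nat.descFactorial_eq_prod_range,
      ← Nat.ascFactorial_eq_prod_range, Nat.descFactorial_self]
    have h3 := Nat.factorial_mul_ascFactorial x x
    rw [add_zero, add_zero, Nat.factorial_succ, ← Nat.cast_mul (x.factorial), h3, two_mul]
    push_cast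
    simp
    ring
  | succ d ih =>
    have h1 : (range (x+1+(d+1))).erase x = insert (x+1+d) ((range (x+1+d)).erase x) := by
      ext y; simp; omega
    rw [h1, prod_insert (by simp), mul_assoc, ih, Nat.factorial_succ,
      show 2*x+1+(d+1) = 2*x+1+d+1 by ring, Nat.factorial_succ]
    push_cast
    ring

theorem prod_odd (N : ℕ) :
    (∏ y ∈ range N, (2*(y:F)+1)) * (2^N * (N.factorial:F)) = ((2*N).factorial : F) := by
  induction N with
  | zero => simp
  | succ N ih =>
    rw [prod_range_succ, show 2*(N+1) = 2*N+1+1 by ring, Nat.factorial_succ (2*N+1),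
      Nat.factorial_succ (2*N), Nat.factorial_succ]
    push_cast
    rw [← ih]; ring

theorem cL_formula (x d : ℕ) :
    cL F (x+1+d) x * ((2*x+1) * 4^(x+d) * ((d.factorial : F) * ((2*x+1+d).factorial : F)))
     = (-1)^x * (∏ y ∈ range (x+1+d), (2*(y:F)+1))^2 := by
  have h := erase_prod (F := F) x d
  have hx : (2*(x:F)+1) ≠ 0 := by exact_mod_cast (by omega : 2*x+1 ≠ 0)
  have hmul := mul_prod_erase (range (x+1+d)) (fun y : ℕ => (2*(y:F)+1)) (a := x) (by simp; omega)
  rw [cL, prod_div_distrib, prod_pow, ← hmul]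
  have hne : (∏ y ∈ (range (x+1+d)).erase x, ((2*(y:F)+1)^2 - (2*(x:F)+1)^2)) ≠ 0 := by
    intro h0
    rw [h0, zero_mul] at h
    have : (-1:F)^x * 4^(x+d) * ((d.factorial : F) * ((2*x+1+d).factorial : F)) ≠ 0 := by
      have := Nat.factorial_ne_zero d
      have := Nat.factorial_ne_zero (2*x+1+d)
      simp only [ne_eq, mul_eq_zero, not_or, Nat.cast_eq_zero]
      refine ⟨⟨by simp, by simp⟩, ‹_›, ‹_›⟩
    exact this h.symm
  have h' : 4^(x+d) * ((d.factorial : F) * ((2*x+1+d).factorial : F)) = (-1)^x *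
     ((∏ y ∈ (range (x+1+d)).erase x, ((2*(y:F)+1)^2 - (2*(x:F)+1)^2)) * (2*x+1)) := by
    have h1 : (-1:F)^x * (-1)^x = 1 := by rw [← mul_pow]; simp
    rw [h]; linear_combination (-(4^(x+d) * ((d.factorial : F) * ((2*x+1+d).factorial : F)))) * h1
  rw [mul_assoc (2*(x:F)+1), h']
  field_simp

end gen

section gam
variable {p : ℕ} [hp : Fact p.Prime]

/-- Morita's Gamma function characterization. -/
def IsGam (G : ℤ_[p] → ℤ_[p]) : Prop := Continuous G ∧ ∀ n : ℕ, G n =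
      (-1) ^ n * ∏ k ∈ (Finset.range n).filter (fun k => ¬ p ∣ k), (k : ℤ_[p])

theorem nat_dvd_padic (n : ℕ) : (p : ℤ_[p]) ∣ (n : ℤ_[p]) ↔ p ∣ n := by
  have := PadicInt.pow_p_dvd_int_iff (p := p) 1 (n : ℤ)
  simp only [pow_one, Int.cast_natCast] at this
  rw [this, Int.natCast_dvd_natCast]

theorem gam_nat_dvd {G : ℤ_[p] → ℤ_[p]} (hG : IsGam G) (n : ℕ) (h : p ∣ n) :
    G ((n:ℤ_[p]) + 1) = - G n := by
  have h1 := hG.2 (n+1)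
  rw [Finset.range_add_one, Finset.filter_insert, if_neg (by simpa using h)] at h1
  push_cast at h1
  rw [h1, hG.2 n]; ring

theorem gam_nat_not {G : ℤ_[p] → ℤ_[p]} (hG : IsGam G) (n : ℕ) (h : ¬ p ∣ n) :
    G ((n:ℤ_[p]) + 1) = - n * G n := by
  have h1 := hG.2 (n+1)
  rw [Finset.range_add_one, Finset.filter_insert, if_pos h, Finset.prod_insert (by simp)] at h1
  push_cast at h1
  rw [h1, hG.2 n]; ring

theorem nat_dense {P : ℤ_[p] → Prop} (hc : IsClosed {x | P x}) (h : ∀ n : ℕ, P n) (x : ℤ_[p]) : P x :=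
  DenseRange.induction_on PadicInt.denseRange_natCast x hc h

theorem gam_dvd {G : ℤ_[p] → ℤ_[p]} (hG : IsGam G) (x : ℤ_[p]) (h : (p:ℤ_[p]) ∣ x) :
    G (x + 1) = - G x := by
  obtain ⟨w, rfl⟩ := h
  have hc := hG.1
  revert w
  apply nat_dense
  · exact isClosed_eq (by fun_prop) (by fun_prop)
  · intro n
    have := gam_nat_dvd hG (p * n) (dvd_mul_right _ _)
    push_cast at this
    exact this

theorem rep (x : ℤ_[p]) : ∃ n : ℕ, n < p ∧ ∃ w : ℤ_[p], x = n + p * w := by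
  obtain ⟨n, hn, h⟩ := PadicInt.exists_mem_range (x := x)
  rw [PadicInt.maximalIdeal_eq_span_p, Ideal.mem_span_singleton] at h
  obtain ⟨w, hw⟩ := h
  exact ⟨n, hn, w, by rw [← hw]; ring⟩

theorem gam_not {G : ℤ_[p] → ℤ_[p]} (hG : IsGam G) (x : ℤ_[p]) (h : ¬ (p:ℤ_[p]) ∣ x) :
    G (x + 1) = - x * G x := by
  obtain ⟨n, _, w, rfl⟩ := rep x
  have hn : ¬ p ∣ n := by
    intro hd
    apply h
    exact dvd_add ((nat_dvd_padic n).2 hd) (dvd_mul_right _ _)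
  clear h
  have hc := hG.1
  revert w
  apply nat_dense
  · exact isClosed_eq (by fun_prop) (by fun_prop)
  · intro w
    have := gam_nat_not hG (n + p * w) (by rwa [Nat.dvd_add_left (dvd_mul_right _ _)])
    push_cast at this
    exact this

theorem gam_zero {G : ℤ_[p] → ℤ_[p]} (hG : IsGam G) : G 0 = 1 := by
  have := hG.2 0
  simpa using this

theorem gam_one {G : ℤ_[p] → ℤ_[p]} (hG : IsGam G) : G 1 = -1 := by
  have := gam_dvd hG 0 (dvd_zero _)
  rw [gam_zero hG] at this
  simpa using this

theorem refl_dvd {G : ℤ_[p] → ℤ_[p]} (hG : IsGam G) (x : ℤ_[p]) (h : (p:ℤ_[p]) ∣ x) :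
    G (x+1) * G (1-(x+1)) = G x * G (1 - x) := by
  rw [gam_dvd hG x h, show 1 - (x+1) = -x by ring, show 1 - x = -x+1 by ring,
    gam_dvd hG (-x) ((dvd_neg).2 h)]
  ring

theorem refl_not {G : ℤ_[p] → ℤ_[p]} (hG : IsGam G) (x : ℤ_[p]) (h : ¬ (p:ℤ_[p]) ∣ x) :
    G (x+1) * G (1-(x+1)) = - (G x * G (1 - x)) := by
  rw [gam_not hG x h, show 1 - (x+1) = -x by ring, show 1 - x = -x+1 by ring,
    gam_not hG (-x) (by rwa [dvd_neg])]
  ring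

theorem refl_step {G : ℤ_[p] → ℤ_[p]} (hG : IsGam G) (w : ℤ_[p]) (n : ℕ) (hn : n + 1 ≤ p) :
    G (p*w+(n+1:ℕ)) * G (1-(p*w+(n+1:ℕ))) = (-1)^n * (G (p*w) * G (1 - p*w)) := by
  induction n with
  | zero => 
    have := refl_dvd hG (p*w) (dvd_mul_right _ _)
    simpa using this
  | succ n ih =>
    have h := refl_not hG (p*w+(n+1:ℕ)) (by
      rw [dvd_add_right (dvd_mul_right _ _), nat_dvd_padic]
      intro hd
      have := Nat.le_of_dvd (by omega) hd
      omega)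
    rw [ih (by omega)] at h
    rw [show (p:ℤ_[p])*w+((n+1+1:ℕ):ℤ_[p]) = p*w+(n+1:ℕ)+1 by push_cast; ring, h]
    ring

theorem refl_mul {G : ℤ_[p] → ℤ_[p]} (hG : IsGam G) (hp2 : p % 2 = 1) (w : ℤ_[p]) :
    G (p*w) * G (1 - p*w) = -1 := by
  have hc := hG.1
  revert w
  apply nat_dense
  · exact isClosed_eq (by fun_prop) (by fun_prop)
  · intro n
    induction n with
    | zero => simp [gam_zero hG, gam_one hG]
    | succ n ih =>
      have h := refl_step hG (n:ℤ_[p]) (p-1) (by have := hp.out.two_le; omega)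
      rw [ih, Even.neg_one_pow (by rw [Nat.even_iff]; omega),
        Nat.sub_add_cancel hp.out.one_le] at h
      rw [show (p:ℤ_[p]) * ((n+1:ℕ):ℤ_[p]) = p*n+p by push_cast; ring, h]
      ring

theorem refl_sq {G : ℤ_[p] → ℤ_[p]} (hG : IsGam G) (hp2 : p % 2 = 1) (x : ℤ_[p]) :
    (G x * G (1 - x))^2 = 1 := by
  obtain ⟨n, hn, w, rfl⟩ := rep x
  rw [add_comm]
  rcases n with _ | n
  · simp [refl_mul hG hp2 w]
  · rw [refl_step hG w n (by omega), refl_mul hG hp2 w]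
    rw [mul_pow, ← pow_mul, mul_comm n 2, pow_mul]; simp

theorem gam_half {G : ℤ_[p] → ℤ_[p]} (hG : IsGam G) (q : ℕ) (hq : p = 4*q+1)
    (c : ℤ_[p]) (hc : 2 * c = 1) : G c ^ 2 = -1 := by
  have h := refl_step hG (-c) (2*q) (by omega)
  rw [refl_mul hG (by omega)] at h
  have hpq : (p:ℤ_[p]) = 4*q+1 := by exact_mod_cast congrArg (Nat.cast : ℕ → ℤ_[p]) hq
  have h1 : (p:ℤ_[p]) * (-c) + ((2*q+1:ℕ):ℤ_[p]) = c := by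
    rw [hpq]; push_cast
    linear_combination (-2*(q:ℤ_[p])-1) * hc
  rw [h1, show 1 - c = c by linear_combination -hc] at h
  rw [sq, h, pow_mul]; simp

theorem gam_norm {G : ℤ_[p] → ℤ_[p]} (hG : IsGam G) (hp2 : p % 2 = 1) (x : ℤ_[p]) : G x ≠ 0 := by
  intro h
  have := refl_sq hG hp2 x
  simp [h] at this

theorem gam_sym {G : ℤ_[p] → ℤ_[p]} (hG : IsGam G) (hp2 : p % 2 = 1) (y : ℤ_[p])
    (hy : (p:ℤ_[p]) ∣ y) (t : ℤ_[p]) : ‖(G (t+y) * G (t-y))^2 - G t ^ 4‖ ≤ ‖y^2‖ := by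
  have hc := hG.1
  revert t
  apply nat_dense
  · exact isClosed_le (by fun_prop) (by fun_prop)
  · intro n
    suffices h : y^2 ∣ (G (n+y) * G (n-y))^2 - G n ^ 4 by
      obtain ⟨c, hc⟩ := h
      rw [hc, norm_mul]
      exact mul_le_of_le_one_right (norm_nonneg _) (PadicInt.norm_le_one _)
    induction n with
    | zero =>
      have h := refl_sq hG hp2 y
      rw [show 1 - y = -y+1 by ring, gam_dvd hG (-y) (by rwa [dvd_neg])] at h
      have : (G (y) * G (-y))^2 = 1 := by rw [← h]; ring
      simp [gam_zero hG, this]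
    | succ n ih =>
      push_cast
      rw [show (n:ℤ_[p])+1+y = n+y+1 by ring, show (n:ℤ_[p])+1-y = n-y+1 by ring]
      by_cases h : (p:ℤ_[p]) ∣ n
      · rw [gam_dvd hG _ h, gam_dvd hG _ (dvd_add h hy), gam_dvd hG _ (dvd_sub h hy)]
        convert ih using 1; ring
      · rw [gam_not hG _ h, gam_not hG (n+y) (by rwa [dvd_add_left hy]),
          gam_not hG (n-y) (by rwa [dvd_sub_left hy])]
        obtain ⟨c, hc⟩ := ih
        refine ⟨n^4 * c + (-2*n^2+y^2) * (G (n+y) * G (n-y))^2, ?_⟩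
        linear_combination (n:ℤ_[p])^4 * hc

theorem gam_asc {G : ℤ_[p] → ℤ_[p]} (hG : IsGam G) (c : ℤ_[p]) (i : ℕ) (hi : i < p)
    (hc : c + i = p * c) (M : ℕ) :
    (∏ j ∈ range M, (c + j)) * (G c * (-1)^M) =
      p ^ ((M+(p-1-i))/p) * (∏ j ∈ range ((M+(p-1-i))/p), (c + j)) * G (c + M) := by
  induction M with
  | zero =>
    have : (0+(p-1-i))/p = 0 := Nat.div_eq_of_lt (by omega)
    rw [this]; simp
  | succ M ih =>
    rw [show M+1+(p-1-i) = M+(p-1-i)+1 by ring, Nat.succ_div]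
    have hs : M+(p-1-i)+1 = M+(p-i) := by omega
    have hcM : c + M = p * (c - 1) + ((M+(p-i) : ℕ) : ℤ_[p]) := by
      rw [Nat.cast_add, Nat.cast_sub hi.le]; linear_combination hc
    have hiff : (p:ℤ_[p]) ∣ c + M ↔ p ∣ M+(p-1-i)+1 := by
      rw [hcM, dvd_add_right (dvd_mul_right _ _), nat_dvd_padic, hs]
    rw [prod_range_succ, pow_succ]
    push_cast
    rw [← add_assoc]
    by_cases hd : p ∣ M+(p-1-i)+1
    · rw [if_pos hd, gam_dvd hG _ (hiff.2 hd)]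
      have hK : (M+(p-1-i)+1)/p = (M+(p-1-i))/p + 1 := by rw [Nat.succ_div, if_pos hd]
      have hcK : c + M = p * (c + ((M+(p-1-i))/p : ℕ)) := by
        have h2 := Nat.mul_div_cancel' hd
        rw [hK, hs] at h2
        rw [hcM, ← h2]; push_cast; ring
      rw [prod_range_succ, pow_succ]
      generalize ((M+(p-1-i))/p : ℕ) = K at *
      generalize ∏ j ∈ range K, (c + (j:ℤ_[p])) = B at *
      linear_combination (-(c+M)) * ih - p^K * B * G (c+M) * hcK
    · rw [if_neg hd, gam_not hG _ (by rwa [hiff]), add_zero]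
      linear_combination (-(c+M)) * ih

theorem cA_int (k : ℕ) : cA ℚ_[p] k * 4^k = (k.centralBinom : ℚ_[p]) := by
  induction k with
  | zero => simp [cA]
  | succ k ih =>
    have h := Nat.succ_mul_centralBinom_succ k
    have h' : ((k:ℚ_[p])+1) * ((k+1).centralBinom : ℚ_[p]) = 2*(2*k+1)*k.centralBinom := by
      exact_mod_cast h
    have h0 : (k:ℚ_[p]) + 1 ≠ 0 := by exact_mod_cast Nat.succ_ne_zero k
    rw [cA_succ]
    apply mul_left_cancel₀ h0
    rw [h', ← ih]
    field_simp
    ring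

theorem norm_two_pow (hp2 : p % 2 = 1) (k : ℕ) : ‖(2:ℚ_[p])^k‖ = 1 := by
  rw [norm_pow]
  have : ‖((2:ℕ):ℚ_[p])‖ = 1 := by
    rw [Padic.norm_natCast_eq_one_iff]
    exact Nat.coprime_two_right.2 (Nat.odd_iff.2 hp2)
  rw [show (2:ℚ_[p]) = ((2:ℕ):ℚ_[p]) by norm_num, this, one_pow]

theorem norm_four_pow (hp2 : p % 2 = 1) (k : ℕ) : ‖(4:ℚ_[p])^k‖ = 1 := by
  rw [show (4:ℚ_[p]) = 2^2 by norm_num, ← pow_mul, norm_two_pow hp2]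

theorem norm_nat_le (n : ℕ) : ‖(n:ℚ_[p])‖ ≤ 1 := by
  simpa using Padic.norm_int_le_one (p := p) n

theorem cA_norm (hp2 : p % 2 = 1) (k : ℕ) : ‖cA ℚ_[p] k‖ ≤ 1 := by
  have h := congrArg norm (cA_int (p := p) k)
  rw [norm_mul, norm_four_pow hp2, mul_one] at h
  rw [h]; exact norm_nat_le _

theorem cA_asc (k : ℕ) : cA ℚ_[p] k = (∏ j ∈ range k, ((1/2:ℚ_[p]) + j)) / (k.factorial : ℚ_[p]) := by
  rw [cA, prod_div_distrib, ← prod_range_add_one_eq_factorial]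
  push_cast; rfl

theorem cA_gam {G : ℤ_[p] → ℤ_[p]} (hG : IsGam G) (q : ℕ) (hq : p = 4*q+1)
    (t : ℤ_[p]) (ht : 4 * t = 1) (z : ℕ) :
    ‖cA ℚ_[p] (p*z+q)^2 - (-(G t : ℚ_[p])^4) * cA ℚ_[p] z ^ 2‖ ≤ ‖(p:ℚ_[p]) * (4*z+1)‖^2 := by
  have hp2 : p % 2 = 1 := by omega
  have hpq : (p:ℤ_[p]) = 4*q+1 := by exact_mod_cast congrArg (Nat.cast : ℕ → ℤ_[p]) hq
  set M := p*z+q with hM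
  set y : ℤ_[p] := p * ((4*z+1)*t) with hy
  have hMc : (M:ℤ_[p]) = p * z + q := by rw [hM]; push_cast; ring
  have hyM : (M:ℤ_[p]) = y - t := by
    rw [hMc, hy, hpq]; linear_combination (-(q+z+4*z*q : ℤ_[p])) * ht
  have h1 := gam_asc hG (2*t) (2*q) (by omega) (by rw [hpq]; push_cast; linear_combination (-2*q:ℤ_[p]) * ht) M
  have h2 := gam_asc hG 1 (4*q) (by omega) (by rw [hpq]; push_cast; ring) M
  rw [show (M+(p-1-2*q))/p = z by
    rw [hM, add_assoc, Nat.mul_add_div hp.out.pos, Nat.div_eq_of_lt (by omega), add_zero]] at h1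
  rw [show (M+(p-1-4*q))/p = z by
    rw [show p - 1 - 4*q = 0 by omega, add_zero, hM, Nat.mul_add_div hp.out.pos,
      Nat.div_eq_of_lt (by omega), add_zero]] at h2
  have hf : ∀ k : ℕ, ∏ j ∈ range k, ((1:ℤ_[p]) + j) = (k.factorial : ℤ_[p]) := by
    intro k
    rw [← prod_range_add_one_eq_factorial]; push_cast
    exact prod_congr rfl fun _ _ => add_comm _ _
  rw [hf, hf, gam_one hG] at h2
  have hh := gam_half hG q hq (2*t) (by linear_combination ht)
  have hr := refl_sq hG hp2 (t - y)
  have e1 : 2*t+(M:ℤ_[p]) = t + y := by rw [hyM]; ring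
  have e2 : 1+(M:ℤ_[p]) = 1 - (t - y) := by rw [hyM]; ring
  rw [e1] at h1
  rw [e2] at h2
  have hs := gam_sym hG hp2 y (dvd_mul_right _ _) t
  -- square everything
  set aM := ∏ j ∈ range M, (2*t + (j:ℤ_[p]))
  set az := ∏ j ∈ range z, (2*t + (j:ℤ_[p]))
  have hsg : ((-1:ℤ_[p])^M)^2 = 1 := by rw [← pow_mul, mul_comm, pow_mul]; simp
  have s1 : - aM^2 = (p^z*az)^2 * G (t+y)^2 := by
    have := congrArg (·^2) h1
    simp only [mul_pow] at this
    rw [hh, hsg] at this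
    rw [mul_pow, ← this]; ring
  have s2 : (M.factorial:ℤ_[p])^2 * G (t-y)^2 = (p^z*z.factorial)^2 := by
    have := congrArg (·^2) h2
    simp only [mul_pow] at this
    rw [hsg] at this
    rw [mul_pow] at hr ⊢
    linear_combination (G (t-y)^2) * this + (p^z)^2 * (z.factorial:ℤ_[p])^2 * hr
  have hcast : ∀ k : ℕ, cA ℚ_[p] k * (k.factorial:ℚ_[p]) = ((∏ j ∈ range k, (2*t + (j:ℤ_[p])) : ℤ_[p]) : ℚ_[p]) := by
    intro k
    rw [cA_asc, div_mul_cancel₀ _ (by exact_mod_cast Nat.factorial_ne_zero k)]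
    have ht2 : (1/2:ℚ_[p]) = 2 * (t:ℚ_[p]) := by
      have := congrArg (fun x : ℤ_[p] => (x:ℚ_[p])) ht
      have h4 : ((4:ℤ_[p]):ℚ_[p]) = 4 := map_ofNat PadicInt.Coe.ringHom 4
      push_cast at this
      rw [h4] at this
      linear_combination (-1/2) * this
    rw [ht2]
    have h2 : ((2:ℤ_[p]):ℚ_[p]) = 2 := map_ofNat PadicInt.Coe.ringHom 2
    refine Eq.trans ?_ (map_prod PadicInt.Coe.ringHom _ _).symm
    refine prod_congr rfl fun j _ => ?_
    change _ = ((2*t + (j:ℤ_[p]) : ℤ_[p]) : ℚ_[p])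
    push_cast
    rw [h2]
  have hM1 := hcast M
  have hz1 := hcast z
  have key : cA ℚ_[p] M ^2 = - cA ℚ_[p] z ^ 2 * (((G (t+y) * G (t-y))^2 : ℤ_[p]) : ℚ_[p]) := by
    have s1' := congrArg (fun x : ℤ_[p] => (x:ℚ_[p])) s1
    have s2' := congrArg (fun x : ℤ_[p] => (x:ℚ_[p])) s2
    push_cast at s1' s2' ⊢
    rw [← hM1, ← hz1] at s1'
    have hne : (M.factorial:ℚ_[p])^2 ≠ 0 := pow_ne_zero _ (by exact_mod_cast Nat.factorial_ne_zero M)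
    apply mul_right_cancel₀ hne
    linear_combination -s1' + (cA ℚ_[p] z)^2 * (G (t+y):ℚ_[p])^2 * s2'
  rw [key]
  have : - cA ℚ_[p] z ^ 2 * (((G (t+y) * G (t-y))^2 : ℤ_[p]) : ℚ_[p]) - (-(G t : ℚ_[p])^4) * cA ℚ_[p] z ^ 2
    = - cA ℚ_[p] z ^ 2 * (((G (t+y) * G (t-y))^2 - G t ^ 4 : ℤ_[p]) : ℚ_[p]) := by
    push_cast; ring
  rw [this, norm_mul, norm_neg, norm_pow]
  refine (mul_le_of_le_one_left (norm_nonneg _) (pow_le_one₀ (norm_nonneg _) (cA_norm hp2 z))).trans ?_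
  refine (show _ ≤ _ from hs).trans ?_
  rw [norm_pow]
  gcongr
  rw [hy, ← mul_assoc, norm_mul]
  refine (mul_le_of_le_one_right (norm_nonneg _) (PadicInt.norm_le_one _)).trans ?_
  rw [PadicInt.norm_def]
  push_cast
  rfl

end gam

section fin
variable {p : ℕ} [hp : Fact p.Prime]

theorem ultra_add {x y : ℚ_[p]} {c : ℝ} (hx : ‖x‖ ≤ c) (hy : ‖y‖ ≤ c) : ‖x + y‖ ≤ c :=
  (Padic.nonarchimedean x y).trans (max_le hx hy)

theorem ultra_sub {x y : ℚ_[p]} {c : ℝ} (hx : ‖x‖ ≤ c) (hy : ‖y‖ ≤ c) : ‖x - y‖ ≤ c := by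
  rw [sub_eq_add_neg]; exact ultra_add hx (by rwa [norm_neg])

theorem ultra_sum {s : Finset ℕ} {f : ℕ → ℚ_[p]} {c : ℝ} (hc : 0 ≤ c) (h : ∀ i ∈ s, ‖f i‖ ≤ c) :
    ‖∑ i ∈ s, f i‖ ≤ c := by
  induction s using Finset.induction_on with
  | empty => simpa using hc
  | insert i s hi ih =>
    rw [sum_insert hi]
    exact ultra_add (h i (mem_insert_self _ _)) (ih fun j hj => h j (mem_insert_of_mem hj))

/-- Multipliers whose tails are small. -/
def GoodQ (N : ℕ) (Q : ℚ_[p] → ℚ_[p]) : Prop :=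
  ∀ j, ‖tau N (fun a => cE j a * Q a)‖ ≤ if j < N then ‖(p:ℚ_[p]) * N‖^2 else 1

theorem pN_le (N : ℕ) : ‖(p:ℚ_[p]) * N‖^2 ≤ 1 := by
  apply pow_le_one₀ (norm_nonneg _)
  exact_mod_cast norm_nat_le (p := p) (p * N)

theorem good_one (hp2 : p % 2 = 1) (N : ℕ) : GoodQ (p := p) N (fun _ => 1) := by
  intro j
  simp only [mul_one]
  split_ifs with h
  · rw [tau_low N j h, norm_zero]; positivity
  · rw [tau_high N j (by omega), norm_pow]
    exact pow_le_one₀ (norm_nonneg _) (cA_norm hp2 j)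

theorem good_mul (N c : ℕ) (Q : ℚ_[p] → ℚ_[p]) (hQ : GoodQ N Q) :
    GoodQ N (fun a => Q a * ((c:ℚ_[p]) - (p * a)^2)) := by
  intro j
  have e : (fun a : ℚ_[p] => cE j a * (Q a * ((c:ℚ_[p]) - (p * a)^2)))
    = fun a => (((c:ℤ) - (p * (2*j+1))^2 : ℤ):ℚ_[p]) * (cE j a * Q a)
        + ((4:ℕ) * (p * (j+1:ℕ))^2) * (cE (j+1) a * Q a) := by
    funext a
    have h0 : (j:ℚ_[p]) + 1 ≠ 0 := by exact_mod_cast Nat.succ_ne_zero j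
    rw [cE_succ]
    push_cast
    field_simp
    ring
  rw [e, tau_add]
  have h1 := hQ j
  have h2 := hQ (j+1)
  apply ultra_add
  · rw [norm_mul]
    exact (mul_le_of_le_one_left (norm_nonneg _) (Padic.norm_int_le_one _)).trans h1
  · rw [norm_mul, norm_mul, norm_pow]
    have h4 := norm_nat_le (p := p) 4
    have h3 := pN_le (p := p) (j+1)
    by_cases hj : j + 1 < N
    · rw [if_pos hj] at h2
      rw [if_pos (by omega)]
      refine (mul_le_of_le_one_left (norm_nonneg _) ?_).trans h2
      exact mul_le_one₀ h4 (by positivity) h3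
    · rw [if_neg hj] at h2
      split_ifs with hj'
      · obtain rfl : N = j+1 := by omega
        refine (mul_le_of_le_one_right (by positivity) h2).trans ?_
        exact mul_le_of_le_one_left (by positivity) h4
      · exact mul_le_one₀ (mul_le_one₀ h4 (by positivity) h3) (norm_nonneg _) h2

theorem split_prod (h : ℕ) (hh : p = 2*h+1) (N k : ℕ) : ∃ Q : ℚ_[p] → ℚ_[p], GoodQ N Q ∧
    ∀ a, ∏ j ∈ range k, ((2*(j:ℚ_[p])+1)^2 - (p*a)^2)
      = (p:ℚ_[p])^(2*((k+h)/p)) * (∏ j ∈ range ((k+h)/p), ((2*(j:ℚ_[p])+1)^2 - a^2)) * Q a := by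
  induction k with
  | zero =>
    refine ⟨_, good_one (by omega) N, fun a => ?_⟩
    rw [Nat.div_eq_of_lt (by omega)]; simp
  | succ k ih =>
    obtain ⟨Q, hQ, hk⟩ := ih
    rw [show k+1+h = k+h+1 by ring]
    by_cases hd : p ∣ k+h+1
    · have hK : (k+h+1)/p = (k+h)/p + 1 := by rw [Nat.succ_div, if_pos hd]
      refine ⟨Q, hQ, fun a => ?_⟩
      have h2 := Nat.mul_div_cancel' hd
      rw [hK] at h2
      have h3 : 2*k+1 = p * (2*((k+h)/p)+1) := by
        have : p * (2*((k+h)/p)+1) + p = 2 * (p * ((k+h)/p + 1)) := by ring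
        rw [h2] at this; omega
      have h4 : 2*(k:ℚ_[p])+1 = p * (2*((k+h)/p : ℕ)+1) := by exact_mod_cast congrArg (Nat.cast : ℕ → ℚ_[p]) h3
      rw [prod_range_succ, hk, hK, prod_range_succ, h4]
      ring
    · have hK : (k+h+1)/p = (k+h)/p := by rw [Nat.succ_div, if_neg hd, add_zero]
      refine ⟨_, good_mul N ((2*k+1)^2) Q hQ, fun a => ?_⟩
      rw [prod_range_succ, hk, hK]
      push_cast
      ring

theorem cE_prod (k : ℕ) (a : ℚ_[p]) : cE k a * (4^k * (k.factorial:ℚ_[p])^2)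
    = ∏ j ∈ range k, ((2*(j:ℚ_[p])+1)^2 - a^2) := by
  induction k with
  | zero => simp [cE]
  | succ k ih =>
    rw [prod_range_succ, ← ih, cE_succ, Nat.factorial_succ]
    have h0 : (k:ℚ_[p]) + 1 ≠ 0 := by exact_mod_cast Nat.succ_ne_zero k
    push_cast
    field_simp
    ring

theorem norm_fact_anti {m n : ℕ} (h : m ≤ n) :
    ‖(n.factorial:ℚ_[p])‖ ≤ ‖(m.factorial:ℚ_[p])‖ := by
  obtain ⟨c, hc⟩ := Nat.factorial_dvd_factorial h
  rw [hc]; push_cast; rw [norm_mul]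
  exact mul_le_of_le_one_right (norm_nonneg _) (norm_nat_le c)

theorem fact_pos (n : ℕ) : 0 < ‖(n.factorial:ℚ_[p])‖ := by
  rw [norm_pos_iff]; exact_mod_cast Nat.factorial_ne_zero n

theorem norm_fact (n : ℕ) : ‖(n.factorial:ℚ_[p])‖ = (p:ℝ)^(-(padicValNat p n.factorial : ℤ)) := by
  rw [Padic.norm_eq_zpow_neg_valuation (by exact_mod_cast Nat.factorial_ne_zero n),
    Padic.valuation_natCast]

theorem norm_fact_mul (K : ℕ) :
    ‖(p:ℚ_[p])^K * (K.factorial:ℚ_[p])‖ = ‖((p*K).factorial:ℚ_[p])‖ := by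
  have hp0 : (p:ℝ) ≠ 0 := by exact_mod_cast hp.out.ne_zero
  rw [norm_mul, norm_fact, norm_fact, padicValNat_factorial_mul, norm_pow, Padic.norm_p,
    ← zpow_natCast, ← zpow_neg_one, ← zpow_mul, ← zpow_add₀ hp0]
  congr 1; push_cast; ring

theorem norm_fact_div (k : ℕ) :
    ‖((p*(k/p)).factorial:ℚ_[p])‖ = ‖(k.factorial:ℚ_[p])‖ := by
  rw [norm_fact, norm_fact, padicValNat_mul_div_factorial]

theorem tau_term (h : ℕ) (hh : p = 2*h+1) (N k : ℕ) (hk : k < p * N) :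
    ‖tau N (fun a : ℚ_[p] => cE k (p * a))‖ ≤ ‖(p:ℚ_[p]) * N‖^2 := by
  have hp2 : p % 2 = 1 := by omega
  obtain ⟨Q, hQ, hs⟩ := split_prod h hh N k
  set K := (k+h)/p with hK
  have hKN : K ≤ N := by
    rw [hK, ← Nat.lt_succ_iff, Nat.div_lt_iff_lt_mul hp.out.pos, Nat.succ_mul, mul_comm N p]; omega
  have hkK : k / p ≤ K := Nat.div_le_div_right (by omega)
  set c : ℚ_[p] := 4^K * (p^K * (K.factorial:ℚ_[p]))^2 / (4^k * (k.factorial:ℚ_[p])^2) with hc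
  have hne : (4^k * (k.factorial:ℚ_[p])^2) ≠ 0 := by
    apply mul_ne_zero (by norm_num)
    apply pow_ne_zero; exact_mod_cast Nat.factorial_ne_zero k
  have e : (fun a : ℚ_[p] => cE k (p * a)) = fun a => c * (cE K a * Q a) + (0:ℚ_[p]) * (0:ℚ_[p]) := by
    funext a
    have h1 := cE_prod (p := p) k ((p:ℚ_[p])*a)
    rw [hs a, ← cE_prod] at h1
    rw [hc, mul_zero, add_zero, div_mul_eq_mul_div, eq_div_iff hne, h1]
    ring
  have hcn : ‖c‖ = (‖((p*K).factorial:ℚ_[p])‖ / ‖(k.factorial:ℚ_[p])‖)^2 := by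
    rw [hc, norm_div, norm_mul, norm_mul, norm_four_pow hp2, norm_four_pow hp2, norm_pow, norm_pow,
      norm_fact_mul]
    ring
  have hc1 : ‖c‖ ≤ 1 := by
    rw [hcn]
    apply pow_le_one₀ (by positivity)
    rw [div_le_one (fact_pos k), ← norm_fact_div k]
    exact norm_fact_anti (Nat.mul_le_mul_left p hkK)
  rw [e, tau_add N c 0 (fun a => cE K a * Q a) (fun _ => 0), zero_mul, add_zero, norm_mul]
  have hq := hQ K
  split_ifs at hq with hlt
  · exact (mul_le_of_le_one_left (norm_nonneg _) hc1).trans hq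
  · have hNK : K = N := by omega
    rw [hNK] at hcn
    refine (mul_le_of_le_one_right (norm_nonneg _) hq).trans ?_
    rw [hcn]
    gcongr
    rw [div_le_iff₀ (fact_pos k)]
    obtain ⟨L, hL⟩ : ∃ L, p * N = L + 1 := ⟨p*N-1, by omega⟩
    have : ((p*N).factorial : ℚ_[p]) = (p * N) * (L.factorial:ℚ_[p]) := by
      rw [hL, Nat.factorial_succ, ← hL]; push_cast; ring
    rw [this, norm_mul]
    gcongr
    exact norm_fact_anti (by omega)

theorem cL_norm (hp2 : p % 2 = 1) (N x : ℕ) (hx : x < N) :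
    ‖cL ℚ_[p] N x‖ * ‖2*(x:ℚ_[p])+1‖ ≤ ‖(N:ℚ_[p])‖ := by
  obtain ⟨d, rfl⟩ : ∃ d, N = x+1+d := ⟨N-(x+1), by omega⟩
  set N := x+1+d with hN
  have h1 := congrArg norm (cL_formula (F := ℚ_[p]) x d)
  have h2 := congrArg norm (prod_odd (F := ℚ_[p]) N)
  rw [← hN] at h1
  set B := ∏ y ∈ range N, (2*(y:ℚ_[p])+1)
  simp only [norm_mul, norm_four_pow hp2, norm_two_pow hp2, norm_pow, norm_neg, norm_one, one_pow,
    one_mul, mul_one] at h1 h2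
  have h2' : ‖(2:ℚ_[p])‖ = 1 := by simpa using norm_two_pow (p := p) hp2 1
  have h3 : ‖((2*N).factorial:ℚ_[p])‖ ≤ ‖(N:ℚ_[p])‖ *
      (‖(d.factorial:ℚ_[p])‖ * ‖((2*x+1+d).factorial:ℚ_[p])‖) := by
    have e1 : (2*N).factorial = 2 * N * (2*x+1+d+d).factorial := by
      rw [show 2*N = 2*x+1+d+d+1 by omega, Nat.factorial_succ]
    have e2 := Nat.add_choose_mul_factorial_mul_factorial d (2*x+1+d)
    rw [e1, show 2*x+1+d+d = d + (2*x+1+d) by ring, ← e2]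
    push_cast
    simp only [norm_mul, h2', one_mul]
    have := norm_nat_le (p := p) ((d + (2*x+1+d)).choose (2*x+1+d))
    rw [mul_assoc ‖(((d + (2*x+1+d)).choose (2*x+1+d) : ℕ) : ℚ_[p])‖]
    refine mul_le_mul_of_nonneg_left ?_ (norm_nonneg _)
    exact mul_le_of_le_one_left (mul_nonneg (norm_nonneg _) (norm_nonneg _)) this
  have h4 : ‖((2*N).factorial:ℚ_[p])‖ ≤ ‖(N.factorial:ℚ_[p])‖^2 := by
    have e2 := Nat.add_choose_mul_factorial_mul_factorial N N
    rw [two_mul, ← e2]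
    push_cast
    simp only [norm_mul]
    rw [mul_assoc, ← sq]
    exact mul_le_of_le_one_left (by positivity) (norm_nat_le _)
  have hDpos : 0 < ‖(d.factorial:ℚ_[p])‖ * ‖((2*x+1+d).factorial:ℚ_[p])‖ :=
    mul_pos (fact_pos _) (fact_pos _)
  set D := ‖(d.factorial:ℚ_[p])‖ * ‖((2*x+1+d).factorial:ℚ_[p])‖
  have hNpos := fact_pos (p := p) N
  have h5 : ‖B‖^2 ≤ ‖(N:ℚ_[p])‖ * D := by
    have : ‖B‖^2 * ‖(N.factorial:ℚ_[p])‖^2 ≤ (‖(N:ℚ_[p])‖ * D) * ‖(N.factorial:ℚ_[p])‖^2 := by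
      rw [← mul_pow, h2, sq]
      exact mul_le_mul h3 h4 (norm_nonneg _) (by positivity)
    exact le_of_mul_le_mul_right this (by positivity)
  rw [← h1, ← mul_assoc] at h5
  exact le_of_mul_le_mul_right h5 hDpos

theorem main_aux {G : ℤ_[p] → ℤ_[p]} (hG : IsGam G) (q : ℕ) (hq : p = 4*q+1)
    (t : ℤ_[p]) (ht : 4 * t = 1) (s : ℕ) :
    ‖∑ k ∈ range (p^(s+1)), cA ℚ_[p] k ^ 3 - (-(G t : ℚ_[p])^4) * ∑ k ∈ range (p^s), cA ℚ_[p] k ^ 3‖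
      ≤ (p:ℝ)^(-((s:ℤ)+2)) := by
  have hp2 : p % 2 = 1 := by omega
  have hp1 : (1:ℝ) ≤ p := by exact_mod_cast hp.out.one_le
  have hp0 : (p:ℝ) ≠ 0 := by positivity
  set N := p^s with hN
  set u : ℚ_[p] := -(G t : ℚ_[p])^4 with hu
  have hNn : ‖(N:ℚ_[p])‖ = (p:ℝ)^(-(s:ℤ)) := by
    rw [hN]; push_cast; rw [norm_pow, Padic.norm_p, zpow_neg, inv_pow, zpow_natCast]
  have hpn : ‖(p:ℚ_[p])‖ = (p:ℝ)^(-1:ℤ) := by rw [Padic.norm_p, zpow_neg_one]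
  let S : ℚ_[p] → ℚ_[p] := fun a => ∑ k ∈ range (p*N), cA ℚ_[p] k * cE k (p*a)
  let T : ℚ_[p] → ℚ_[p] := fun a => ∑ k ∈ range N, cA ℚ_[p] k * cE k a
  have hS0 : S 0 = ∑ k ∈ range (p^(s+1)), cA ℚ_[p] k ^ 3 := by
    simp only [S, mul_zero, cE_zero_right]
    rw [hN, pow_succ']
    exact sum_congr rfl fun _ _ => by ring
  have hT0 : T 0 = ∑ k ∈ range N, cA ℚ_[p] k ^ 3 := by
    simp only [T, cE_zero_right]
    exact sum_congr rfl fun _ _ => by ring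
  have hε : (0:ℝ) ≤ (p:ℝ)^(-((s:ℤ)+2)) := by positivity
  -- tails
  have hτS : ‖tau N S‖ ≤ (p:ℝ)^(-((s:ℤ)+2)) := by
    have := tau_sum (range (p*N)) N (cA ℚ_[p]) (fun k a => cE k (p*a))
    change ‖tau N (fun a : ℚ_[p] => ∑ k ∈ range (p*N), cA ℚ_[p] k * cE k (p*a))‖ ≤ _
    rw [this]
    apply ultra_sum hε
    intro k hk
    rw [norm_mul]
    refine (mul_le_of_le_one_left (norm_nonneg _) (cA_norm hp2 k)).trans ?_
    refine (tau_term (2*q) (by omega) N k (mem_range.1 hk)).trans ?_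
    rw [norm_mul, hNn, hpn, ← zpow_add₀ hp0, ← zpow_natCast, ← zpow_mul]
    apply zpow_le_zpow_right₀ hp1
    push_cast; omega
  have hτT : tau N T = 0 := by
    have := tau_sum (range N) N (cA ℚ_[p]) (fun k a => cE k a)
    change tau N (fun a : ℚ_[p] => ∑ k ∈ range N, cA ℚ_[p] k * cE k a) = _
    rw [this]
    apply sum_eq_zero
    intro k hk
    have := tau_low (F := ℚ_[p]) N k (mem_range.1 hk)
    change _ * tau N (cE k) = 0
    rw [this, mul_zero]
  have hval : ∀ x ∈ range N, ‖S (2*(x:ℚ_[p])+1) - u * T (2*(x:ℚ_[p])+1)‖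
      ≤ ‖(p:ℚ_[p]) * (2*x+1)‖^2 := by
    intro x hx
    have hx := mem_range.1 hx
    have hbd : p*x+2*q < p*N := by
      have : p * (x+1) ≤ p*N := Nat.mul_le_mul_left p hx
      rw [mul_add] at this; omega
    have hpc : (p:ℚ_[p]) = 4*q+1 := by exact_mod_cast congrArg (Nat.cast : ℕ → ℚ_[p]) hq
    have harg : (p:ℚ_[p]) * (2*x+1) = 2*((p*x+2*q : ℕ):ℚ_[p])+1 := by
      push_cast; linear_combination hpc
    have hSx : S (2*(x:ℚ_[p])+1) = ∑ k ∈ range (p*N), cA ℚ_[p] k * cE k (2*((p*x+2*q : ℕ):ℚ_[p])+1) := by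
      simp only [S]; rw [harg]
    have hTx : T (2*(x:ℚ_[p])+1) = ∑ k ∈ range N, cA ℚ_[p] k * cE k (2*(x:ℚ_[p])+1) := rfl
    rcases Nat.even_or_odd' x with ⟨z, rfl | rfl⟩
    · rw [show p*(2*z)+2*q = 2*(p*z+q) by ring] at hSx hbd
      rw [sum_even _ _ hbd] at hSx
      rw [sum_even _ _ hx] at hTx
      rw [hSx, hTx]
      convert cA_gam hG q hq t ht z using 4
      push_cast; ring
    · obtain ⟨w, hw⟩ : ∃ w, p*(2*z+1)+2*q = 2*w+1 := ⟨p*z+3*q, by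
        have : p*(2*z+1) = 2*(p*z)+p := by ring
        rw [this]; omega⟩
      rw [hw] at hSx hbd
      rw [sum_odd _ _ hbd] at hSx
      rw [sum_odd _ _ hx] at hTx
      rw [hSx, hTx]
      simp; positivity
  have hfin : S 0 - u * T 0 = tau N S - u * tau N T
      + ∑ x ∈ range N, cL ℚ_[p] N x * (S (2*(x:ℚ_[p])+1) - u * T (2*(x:ℚ_[p])+1)) := by
    have e : ∀ x, cL ℚ_[p] N x * (S (2*(x:ℚ_[p])+1) - u * T (2*(x:ℚ_[p])+1))
      = cL ℚ_[p] N x * S (2*(x:ℚ_[p])+1) - u * (cL ℚ_[p] N x * T (2*(x:ℚ_[p])+1)) := fun x => by ring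
    simp only [e, sum_sub_distrib, ← mul_sum, tau]
    ring
  rw [← hS0, ← hT0, hfin, hτT, mul_zero, sub_zero]
  apply ultra_add hτS
  apply ultra_sum hε
  intro x hx
  rw [norm_mul]
  have h1 := cL_norm hp2 N x (mem_range.1 hx)
  have h2 := hval x hx
  have h3 : ‖2*(x:ℚ_[p])+1‖ ≤ 1 := by exact_mod_cast norm_nat_le (p := p) (2*x+1)
  calc _ ≤ ‖cL ℚ_[p] N x‖ * ‖(p:ℚ_[p]) * (2*x+1)‖^2 := by gcongr
    _ = (‖cL ℚ_[p] N x‖ * ‖2*(x:ℚ_[p])+1‖) * (‖(p:ℚ_[p])‖^2 * ‖2*(x:ℚ_[p])+1‖) := by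
      rw [norm_mul]; ring
    _ ≤ ‖(N:ℚ_[p])‖ * (‖(p:ℚ_[p])‖^2 * 1) := by gcongr
    _ = _ := by
      rw [hNn, hpn, mul_one, ← zpow_natCast, ← zpow_mul, ← zpow_add₀ hp0]
      congr 1; push_cast; ring

end fin

theorem stmt14 (p : ℕ) [Fact p.Prime] (hp4 : p % 4 = 1) (r : ℕ) (hr : 0 < r)
    (G : ℤ_[p] → ℤ_[p]) (hGcont : Continuous G)
    (hGval : ∀ n : ℕ, G n =
      (-1) ^ n * ∏ k ∈ (Finset.range n).filter (fun k => ¬ p ∣ k), (k : ℤ_[p]))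
    (quarter : ℤ_[p]) (hquarter : 4 * quarter = 1) :
    ‖(∑ k ∈ Finset.range (p ^ r),
          (asc (1/2) k) ^ 3 / (k.factorial : ℚ_[p]) ^ 3)
      - (-(G quarter : ℚ_[p]) ^ 4)
          * ∑ k ∈ Finset.range (p ^ (r - 1)),
              (asc (1/2) k) ^ 3 / (k.factorial : ℚ_[p]) ^ 3‖
      ≤ (p : ℝ) ^ (-((r : ℤ) + 1)) := by
  obtain ⟨s, rfl⟩ : ∃ s, r = s + 1 := ⟨r - 1, by omega⟩
  have h := main_aux (G := G) ⟨hGcont, hGval⟩ (p/4) (by omega) quarter hquarter s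
  have e : ∀ k : ℕ, (asc (1/2) k) ^ 3 / (k.factorial : ℚ_[p]) ^ 3 = cA ℚ_[p] k ^ 3 := by
    intro k
    rw [cA_asc, div_pow, asc]
  simp only [e, Nat.add_sub_cancel]
  convert h using 2
  push_cast; ring
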